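/- arXiv:2408.17331 — 2 statements merged into one kernel-verified Lean document; each statement's English description precedes it below -/
import Mathlib

section
/- Let n ≥ 1 be an odd integer and let 0 < s ≤ π. The map g_n : VR^m(S^1; π−s) → VR^m(S^1; π−s/n) is continuous and injective, and its image is exactly the fixed-point set of the rotation by 2π/n, i.e., the set of μ ∈ VR^m(S^1; π−s/n) with (2π/n)·μ = μ. -/
open MeasureTheory Metric Set
open scoped NNReal ENNReal

noncomputable section

/-- The circle `S¹ = ℝ/2πℤ`, with the quotient (geodesic) metric. -/
abbrev Circ : Type := AddCircle (2 * Real.pi)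

instance : Fact (0 < 2 * Real.pi) := ⟨by positivity⟩

/-- The support of a finitely-supported measure: the set of atoms. -/
def mSupport {X : Type*} [MeasurableSpace X] (μ : ProbabilityMeasure X) : Set X :=
  {x | μ.toMeasure {x} ≠ 0}

/-- A probability measure is finitely supported if some finite set has full measure. -/
def FinSupp {X : Type*} [MeasurableSpace X] (μ : ProbabilityMeasure X) : Prop :=
  ∃ S : Finset X, μ.toMeasure ↑S = 1

/-- The Vietoris--Rips metric thickening `VR^m(X; r)`: the set of finitely supported
probability measures on `X` whose support has diameter at most `r`, topologized as a subspace
of the probability measures on `X` with the topology of weak convergence. -/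
def VRm (X : Type*) [MetricSpace X] [MeasurableSpace X] (r : ℝ) :
    Set (ProbabilityMeasure X) :=
  {μ | FinSupp μ ∧ Metric.diam (mSupport μ) ≤ r}

/-- The rotation action of the circle group `ℝ/2πℤ` on probability measures on the circle:
`θ · Σ_j a_j δ_{θ_j} = Σ_j a_j δ_{θ+θ_j}`. -/
def rot (θ : Circ) (μ : ProbabilityMeasure Circ) : ProbabilityMeasure Circ :=
  μ.map (f := fun x => θ + x) (continuous_add_left θ).measurable.aemeasurable

/-- The representative in `[0, 2π)` of a point of the circle `ℝ/2πℤ`. -/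
def rep (x : Circ) : ℝ := (AddCircle.equivIco (2 * Real.pi) 0 x : ℝ)

/-- The `t`-th branch `x ↦ x/n + 2πt/n` of the inverse of the `n`-fold cover of the circle,
using the representative of `x` in `[0, 2π)`. -/
def divMap (n : ℕ) (t : ℕ) (x : Circ) : Circ :=
  ((rep x / n + 2 * Real.pi * t / n : ℝ) : Circ)

lemma measurable_rep : Measurable rep := by
  have : rep = fun x => ((AddCircle.measurableEquivIco (2 * Real.pi) 0 x : ℝ)) := rfl
  rw [this]
  exact measurable_subtype_coe.comp (AddCircle.measurableEquivIco (2 * Real.pi) 0).measurable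

lemma measurable_divMap (n t : ℕ) : Measurable (divMap n t) := by
  apply Measurable.comp (f := fun x => (rep x / n + 2 * Real.pi * t / n : ℝ))
    (g := fun y : ℝ => (y : Circ))
  · exact AddCircle.measurable_mk'
  · exact (measurable_rep.div_const _).add_const _

/-- The measure `g_n(μ) = Σ_{t<n} (1/n) (divMap n t)_* μ`.  For `μ = Σ_j a_j δ_{θ_j}` with
`θ_j ∈ [0, 2π)` this is `Σ_{t<n} Σ_j (a_j/n) δ_{θ_j/n + 2πt/n}`. -/
def gm (n : ℕ) (μ : ProbabilityMeasure Circ) : Measure Circ :=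
  ∑ t : Fin n, (n : ℝ≥0∞)⁻¹ • (μ.toMeasure.map (divMap n t))

lemma isProbabilityMeasure_gm (n : ℕ) (hn : n ≠ 0) (μ : ProbabilityMeasure Circ) :
    IsProbabilityMeasure (gm n μ) := by
  constructor
  rw [gm, Measure.finset_sum_apply]
  have : ∀ t : Fin n, ((n : ℝ≥0∞)⁻¹ • (μ.toMeasure.map (divMap n (t : ℕ)))) univ
      = (n : ℝ≥0∞)⁻¹ := by
    intro t
    rw [Measure.smul_apply, Measure.map_apply (measurable_divMap n t) MeasurableSet.univ]
    simp
  rw [Finset.sum_congr rfl fun t _ => this t]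
  rw [Finset.sum_const, Finset.card_univ, Fintype.card_fin, nsmul_eq_mul]
  exact ENNReal.mul_inv_cancel (by exact_mod_cast hn) (by simp)

/-- The map `g_n` on probability measures on the circle. -/
def gPM (n : ℕ) (hn : n ≠ 0) (μ : ProbabilityMeasure Circ) : ProbabilityMeasure Circ :=
  ⟨gm n μ, isProbabilityMeasure_gm n hn μ⟩

/-! ### Metric facts on the circle -/

lemma exists_small_rep (w : Circ) : ∃ r : ℝ, (r : Circ) = w ∧ |r| = ‖w‖ ∧ |r| ≤ Real.pi := by
  have hp : |2 * Real.pi| / 2 = Real.pi := by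
    rw [abs_of_pos (by positivity)]; ring
  have hle : ‖w‖ ≤ Real.pi := by
    have := AddCircle.norm_le_half_period (2 * Real.pi) (x := w) (by positivity)
    rwa [hp] at this
  induction w using QuotientAddGroup.induction_on with
  | H x =>
    refine ⟨x - round ((2 * Real.pi)⁻¹ * x) * (2 * Real.pi), ?_, ?_, ?_⟩
    · have : ((round ((2 * Real.pi)⁻¹ * x) * (2 * Real.pi) : ℝ) : Circ) = 0 := by
        rw [AddCircle.coe_eq_zero_iff]
        exact ⟨round ((2 * Real.pi)⁻¹ * x), by simp⟩
      rw [AddCircle.coe_sub, this, sub_zero]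
    · exact (AddCircle.norm_eq (2 * Real.pi)).symm
    · rw [← AddCircle.norm_eq (2 * Real.pi)]; exact hle

lemma norm_coe_of_le {r : ℝ} (h : |r| ≤ Real.pi) : ‖(r : Circ)‖ = |r| := by
  rw [AddCircle.norm_coe_eq_abs_iff _ (by positivity), abs_of_pos (by positivity : 0 < 2 * Real.pi)]
  linarith

lemma pi_add_pi : ((Real.pi : ℝ) : Circ) + ((Real.pi : ℝ) : Circ) = 0 := by
  rw [← AddCircle.coe_add, ← two_mul]; exact AddCircle.coe_period _

lemma odd_nsmul_pi {n : ℕ} (h : Odd n) : n • ((Real.pi : ℝ) : Circ) = ((Real.pi : ℝ) : Circ) := by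
  obtain ⟨k, rfl⟩ := h
  have h2 : 2 • ((Real.pi : ℝ) : Circ) = 0 := (two_nsmul _).trans pi_add_pi
  rw [add_nsmul, mul_nsmul, h2, one_nsmul, nsmul_zero, zero_add]

lemma norm_add_pi (z : Circ) : ‖z + ((Real.pi : ℝ) : Circ)‖ = Real.pi - ‖z‖ := by
  obtain ⟨r, rfl, h1, h2⟩ := exists_small_rep z
  rw [← h1]
  rcases le_total 0 r with h | h
  · have : (r : Circ) + ((Real.pi : ℝ) : Circ) = ((r - Real.pi : ℝ) : Circ) := by
      rw [AddCircle.coe_sub, sub_eq_add_neg, add_right_inj, eq_neg_iff_add_eq_zero, pi_add_pi]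
    rw [abs_of_nonneg h] at *
    have h3 : |r - Real.pi| = Real.pi - r := by rw [abs_of_nonpos (by linarith)]; ring
    rw [this, norm_coe_of_le, h3]
    rw [h3]; linarith
  · rw [abs_of_nonpos h] at *
    have h3 : |r + Real.pi| = Real.pi + r := by rw [abs_of_nonneg (by linarith)]; ring
    rw [← AddCircle.coe_add, norm_coe_of_le, h3]
    · ring
    rw [h3]; linarith

lemma exists_div {n : ℕ} (hn : 1 ≤ n) (w : Circ) : ∃ z : Circ, n • z = w ∧ n * ‖z‖ = ‖w‖ := by
  obtain ⟨r, rfl, h1, h2⟩ := exists_small_rep w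
  have hn' : (1 : ℝ) ≤ n := by exact_mod_cast hn
  have h0 : (n : ℝ) ≠ 0 := by positivity
  have h3 : |r / n| = |r| / n := by rw [abs_div, abs_of_nonneg (by positivity : (0 : ℝ) ≤ n)]
  refine ⟨((r / n : ℝ) : Circ), ?_, ?_⟩
  · rw [← AddCircle.coe_nsmul, nsmul_eq_mul, mul_div_cancel₀ _ h0]
  · rw [norm_coe_of_le, ← h1, h3, mul_div_cancel₀ _ h0]
    rw [h3]
    exact (div_le_self (abs_nonneg _) hn').trans h2

lemma dist_up {n : ℕ} (hodd : Odd n) (hn : 1 ≤ n) {s : ℝ} {y y' : Circ}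
    (h : dist (n • y) (n • y') ≤ Real.pi - s) : dist y y' ≤ Real.pi - s / n := by
  have hn' : (0 : ℝ) < n := by exact_mod_cast hn
  rw [dist_eq_norm] at *
  have h1 := norm_add_pi (y - y')
  have h2 := norm_add_pi (n • y - n • y')
  have h3 : n • y - n • y' + ((Real.pi : ℝ) : Circ) = n • (y - y' + ((Real.pi : ℝ) : Circ)) := by
    rw [smul_add, smul_sub, odd_nsmul_pi hodd]
  have h4 : ‖n • (y - y' + ((Real.pi : ℝ) : Circ))‖ ≤ n * ‖y - y' + ((Real.pi : ℝ) : Circ)‖ :=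
    norm_nsmul_le
  rw [← h3, h2, h1] at h4
  have : s / n ≤ Real.pi - ‖y - y'‖ := by
    rw [div_le_iff₀ hn']; linarith
  linarith

lemma dist_down {n : ℕ} (hodd : Odd n) (hn : 1 ≤ n) {s : ℝ} {x x' : Circ}
    (h : ∀ y y' : Circ, n • y = x → n • y' = x' → dist y y' ≤ Real.pi - s / n) :
    dist x x' ≤ Real.pi - s := by
  have hn' : (0 : ℝ) < n := by exact_mod_cast hn
  obtain ⟨z, hz, hz'⟩ := exists_div hn (x - x' + ((Real.pi : ℝ) : Circ))
  obtain ⟨y', hy', -⟩ := exists_div hn x'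
  have h1 := h (y' + (z + ((Real.pi : ℝ) : Circ))) y' (by
    rw [smul_add, smul_add, hz, hy', odd_nsmul_pi hodd, add_assoc, pi_add_pi]; abel) hy'
  rw [dist_eq_norm, add_sub_cancel_left, norm_add_pi] at h1
  rw [norm_add_pi] at hz'
  rw [dist_eq_norm]
  have : s / n ≤ ‖z‖ := by linarith
  rw [div_le_iff₀ hn'] at this
  linarith

/-! ### Fibres of the `n`-fold cover -/

lemma coe_rep (x : Circ) : ((rep x : ℝ) : Circ) = x := AddCircle.coe_equivIco

lemma divMap_eq (n t : ℕ) (x : Circ) :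
    divMap n t x = ((rep x / n : ℝ) : Circ) + t • ((2 * Real.pi / n : ℝ) : Circ) := by
  rw [divMap, AddCircle.coe_add, ← AddCircle.coe_nsmul, nsmul_eq_mul]
  congr 3; ring

lemma nsmul_c {n : ℕ} (hn : 1 ≤ n) : n • ((2 * Real.pi / n : ℝ) : Circ) = 0 := by
  have h0 : (n : ℝ) ≠ 0 := by positivity
  rw [← AddCircle.coe_nsmul, nsmul_eq_mul, mul_div_cancel₀ _ h0]; exact AddCircle.coe_period _

lemma nsmul_divMap {n : ℕ} (hn : 1 ≤ n) (t : ℕ) (x : Circ) : n • divMap n t x = x := by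
  have h0 : (n : ℝ) ≠ 0 := by positivity
  rw [divMap_eq, smul_add, smul_comm n t, nsmul_c hn, smul_zero, add_zero,
    ← AddCircle.coe_nsmul, nsmul_eq_mul, mul_div_cancel₀ _ h0, coe_rep]

lemma exists_shift {n : ℕ} (hn : 1 ≤ n) (y : Circ) : ∃ m < n,
    y = ((rep (n • y) / n : ℝ) : Circ) + m • ((2 * Real.pi / n : ℝ) : Circ) := by
  have h : n • (y - divMap n 0 (n • y)) = 0 := by
    rw [smul_sub, nsmul_divMap hn, sub_self]
  rw [AddCircle.nsmul_eq_zero_iff hn] at h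
  obtain ⟨m, hm, h⟩ := h
  refine ⟨m, hm, ?_⟩
  rw [divMap_eq, zero_smul, add_zero] at h
  rw [eq_sub_iff_add_eq] at h
  have e : (m / n * (2 * Real.pi) : ℝ) = m * (2 * Real.pi / n) := by ring
  rw [e] at h
  rw [← AddCircle.coe_nsmul, nsmul_eq_mul, add_comm, h]

lemma exists_divMap {n : ℕ} (hn : 1 ≤ n) (y : Circ) : ∃ t : Fin n, divMap n t (n • y) = y := by
  obtain ⟨m, hm, h⟩ := exists_shift hn y
  exact ⟨⟨m, hm⟩, by rw [divMap_eq]; exact h.symm⟩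

lemma sum_shift {β : Type*} [AddCommMonoid β] (n m : ℕ) (G : Circ → β) (c : Circ)
    (hc : n • c = 0) (u : Circ) :
    ∑ k ∈ Finset.range n, G (u + m • c + k • c) = ∑ k ∈ Finset.range n, G (u + k • c) := by
  induction m with
  | zero => simp
  | succ m ih =>
    rw [← ih]
    have h1 := Finset.sum_range_succ' (fun k => G (u + m • c + k • c)) n
    have h2 := Finset.sum_range_succ (fun k => G (u + m • c + k • c)) n
    rcases n with _ | n
    · simp
    rw [Finset.sum_range_succ, Finset.sum_range_succ' (fun k => G (u + m • c + k • c))]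
    congr 1
    · refine Finset.sum_congr rfl fun k _ => ?_
      congr 1; simp only [succ_nsmul]; abel
    · congr 1
      rw [zero_smul, add_zero]
      calc u + (m + 1) • c + n • c = u + m • c + (n + 1) • c := by simp only [succ_nsmul]; abel
        _ = _ := by rw [hc, add_zero]

lemma sum_divMap {β : Type*} [AddCommMonoid β] {n : ℕ} (hn : 1 ≤ n) (G : Circ → β) (y : Circ) :
    ∑ t : Fin n, G (divMap n t (n • y))
      = ∑ k ∈ Finset.range n, G (y + k • ((2 * Real.pi / n : ℝ) : Circ)) := by
  obtain ⟨m, hm, h⟩ := exists_shift hn y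
  rw [Fin.sum_univ_eq_sum_range (fun t => G (divMap n t (n • y))) n]
  conv_rhs => rw [h]
  rw [sum_shift n m G _ (nsmul_c hn)]
  simp only [divMap_eq]

/-! ### The measure `gm` -/

lemma measurable_q (n : ℕ) : Measurable (fun y : Circ => n • y) :=
  (continuous_nsmul n).measurable

lemma gm_apply (n : ℕ) (μ : ProbabilityMeasure Circ) {B : Set Circ} (hB : MeasurableSet B) :
    gm n μ B = (n : ℝ≥0∞)⁻¹ * ∑ t : Fin n, μ.toMeasure (divMap n t ⁻¹' B) := by
  rw [gm, Measure.finset_sum_apply, Finset.mul_sum]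
  refine Finset.sum_congr rfl fun t _ => ?_
  rw [Measure.smul_apply, Measure.map_apply (measurable_divMap n t) hB, smul_eq_mul]

lemma gm_preimage {n : ℕ} (hn : 1 ≤ n) (μ : ProbabilityMeasure Circ) {B : Set Circ}
    (hB : MeasurableSet B) : gm n μ ((fun y : Circ => n • y) ⁻¹' B) = μ.toMeasure B := by
  rw [gm_apply n μ (measurable_q n hB)]
  have : ∀ t : Fin n, divMap n t ⁻¹' ((fun y : Circ => n • y) ⁻¹' B) = B := by
    intro t; ext x; simp [nsmul_divMap hn]
  simp only [this, Finset.sum_const, Finset.card_univ, Fintype.card_fin, nsmul_eq_mul]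
  rw [← mul_assoc, ENNReal.inv_mul_cancel (by exact_mod_cast (by omega : n ≠ 0)) (by simp), one_mul]

lemma gPM_injective {n : ℕ} (hn : 1 ≤ n) (h0 : n ≠ 0) : Function.Injective (gPM n h0) := by
  intro μ ν h
  apply Subtype.ext
  apply Measure.ext
  intro B hB
  have h' : gm n μ = gm n ν := congrArg Subtype.val h
  have := gm_preimage hn μ hB
  rw [h', gm_preimage hn ν hB] at this
  exact this.symm

lemma mem_mSupport_gPM {n : ℕ} (hn : 1 ≤ n) (h0 : n ≠ 0) (μ : ProbabilityMeasure Circ) (y : Circ) :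
    y ∈ mSupport (gPM n h0 μ) ↔ n • y ∈ mSupport μ := by
  change gm n μ {y} ≠ 0 ↔ μ.toMeasure {n • y} ≠ 0
  refine not_congr ⟨fun h => ?_, fun h => ?_⟩
  · rw [gm_apply n μ (measurableSet_singleton y), mul_eq_zero] at h
    have h := h.resolve_left (by simp)
    rw [Finset.sum_eq_zero_iff] at h
    obtain ⟨t, ht⟩ := exists_divMap hn y
    refine measure_mono_null ?_ (h t (Finset.mem_univ _))
    rintro x rfl
    exact ht
  · rw [← gm_preimage hn μ (measurableSet_singleton _)] at h
    refine measure_mono_null ?_ h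
    rintro x rfl
    rfl

lemma finSupp_gPM {n : ℕ} (hn : 1 ≤ n) (h0 : n ≠ 0) {μ : ProbabilityMeasure Circ}
    (h : FinSupp μ) : FinSupp (gPM n h0 μ) := by
  classical
  obtain ⟨S, hS⟩ := h
  refine ⟨Finset.univ.biUnion fun t : Fin n => S.image (divMap n t), ?_⟩
  refine le_antisymm prob_le_one ?_
  rw [← hS, ← gm_preimage hn μ S.measurableSet]
  refine measure_mono ?_
  intro y hy
  obtain ⟨t, ht⟩ := exists_divMap hn y
  simp only [Finset.coe_biUnion, Finset.coe_image, mem_iUnion]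
  exact ⟨t, by simp, n • y, hy, ht⟩

lemma continuous_gPM {n : ℕ} (hn : 1 ≤ n) (h0 : n ≠ 0) : Continuous (gPM n h0) := by
  rw [ProbabilityMeasure.continuous_iff_forall_continuousMap_continuous_integral]
  intro f
  have hsurj : Function.Surjective (fun y : Circ => n • y) := fun w =>
    (exists_div hn w).imp fun z hz => hz.1
  have hq : Topology.IsQuotientMap (fun y : Circ => n • y) :=
    (continuous_nsmul n).isClosedMap.isQuotientMap (continuous_nsmul n) hsurj
  have hT : Continuous (fun x : Circ => (n : ℝ)⁻¹ * ∑ t : Fin n, f (divMap n t x)) := by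
    rw [hq.continuous_iff]
    have : (fun x : Circ => (n : ℝ)⁻¹ * ∑ t : Fin n, f (divMap n t x)) ∘ (fun y : Circ => n • y)
        = fun y => (n : ℝ)⁻¹ * ∑ k ∈ Finset.range n, f (y + k • ((2 * Real.pi / n : ℝ) : Circ)) := by
      funext y
      simp only [Function.comp]
      rw [sum_divMap hn (fun z => f z) y]
    rw [this]
    fun_prop
  have hfint : ∀ (μ : Measure Circ) [IsProbabilityMeasure μ] (t : ℕ),
      Integrable (fun x => f (divMap n t x)) μ := by
    intro μ _ t
    refine Integrable.of_bound
      (f.continuous.measurable.comp (measurable_divMap n t)).aestronglyMeasurable ‖f‖ ?_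
    exact Filter.Eventually.of_forall fun x => f.norm_coe_le_norm _
  have key : ∀ μ : ProbabilityMeasure Circ, ∫ x, f x ∂(gPM n h0 μ).toMeasure
      = ∫ x, (n : ℝ)⁻¹ * ∑ t : Fin n, f (divMap n t x) ∂μ.toMeasure := by
    intro μ
    change ∫ x, f x ∂(gm n μ) = _
    have hmap : ∀ t : Fin n, IsProbabilityMeasure (μ.toMeasure.map (divMap n t)) := fun t =>
      Measure.isProbabilityMeasure_map (measurable_divMap n t).aemeasurable
    have hf : ∀ t : Fin n, Integrable f (μ.toMeasure.map (divMap n t)) := fun t =>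
      Integrable.of_bound f.continuous.measurable.aestronglyMeasurable ‖f‖
        (Filter.Eventually.of_forall fun x => f.norm_coe_le_norm _)
    rw [gm, integral_finsetSum_measure (fun t _ => (hf t).smul_measure (by simpa using h0)),
      integral_const_mul, integral_finsetSum _ (fun (t : Fin n) _ => hfint μ.toMeasure (t : ℕ)), Finset.mul_sum]
    refine Finset.sum_congr rfl fun t _ => ?_
    rw [integral_smul_measure, integral_map (measurable_divMap n t).aemeasurable
      f.continuous.measurable.aestronglyMeasurable]
    simp
  simp only [key]
  exact ProbabilityMeasure.continuous_integral_continuousMap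
    (⟨_, hT⟩ : C(Circ, ℝ))

lemma rot_gPM {n : ℕ} (hn : 1 ≤ n) (h0 : n ≠ 0) (μ : ProbabilityMeasure Circ) :
    rot ((2 * Real.pi / n : ℝ) : Circ) (gPM n h0 μ) = gPM n h0 μ := by
  apply Subtype.ext
  apply Measure.ext
  intro B hB
  have hm := (continuous_add_left ((2 * Real.pi / n : ℝ) : Circ)).measurable
  change (gm n μ).map (fun x => ((2 * Real.pi / n : ℝ) : Circ) + x) B = gm n μ B
  rw [Measure.map_apply hm hB, gm_apply n μ hB, gm_apply n μ (hm hB)]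
  congr 1
  have : ∀ A : Set Circ, MeasurableSet A → ∑ t : Fin n, μ.toMeasure (divMap n t ⁻¹' A)
      = ∫⁻ x, ∑ t : Fin n, A.indicator (fun _ => (1 : ℝ≥0∞)) (divMap n t x) ∂μ.toMeasure := by
    intro A hA
    rw [lintegral_finsetSum]
    swap
    · exact fun t _ => (measurable_const.indicator hA).comp (measurable_divMap n t)
    refine Finset.sum_congr rfl fun t _ => ?_
    rw [← lintegral_indicator_one (measurable_divMap n t hA)]
    rfl
  rw [this B hB, this _ (hm hB)]
  refine lintegral_congr fun x => ?_
  obtain ⟨y, rfl, -⟩ := exists_div hn x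
  rw [sum_divMap hn (fun z => B.indicator (fun _ => (1 : ℝ≥0∞)) z),
    sum_divMap hn (fun z => ((fun x => ((2 * Real.pi / n : ℝ) : Circ) + x) ⁻¹' B).indicator
      (fun _ => (1 : ℝ≥0∞)) z),
    ← sum_shift n 1 (fun z => B.indicator (fun _ => (1 : ℝ≥0∞)) z) _ (nsmul_c hn)]
  refine Finset.sum_congr rfl fun k _ => ?_
  have : y + 1 • ((2 * Real.pi / n : ℝ) : Circ) + k • ((2 * Real.pi / n : ℝ) : Circ)
    = ((2 * Real.pi / n : ℝ) : Circ) + (y + k • ((2 * Real.pi / n : ℝ) : Circ)) := by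
    rw [one_smul]; abel
  rw [this]
  rfl

lemma gPM_map {n : ℕ} (hn : 1 ≤ n) (h0 : n ≠ 0) (ν : ProbabilityMeasure Circ)
    (hν : rot ((2 * Real.pi / n : ℝ) : Circ) ν = ν) :
    gPM n h0 (ν.map (f := fun y => n • y) (measurable_q n).aemeasurable) = ν := by
  have hm := fun k : ℕ => (continuous_add_right (k • ((2 * Real.pi / n : ℝ) : Circ))).measurable
  have hinv : ∀ B : Set Circ, MeasurableSet B → ∀ k : ℕ,
      ν.toMeasure ((fun y => y + k • ((2 * Real.pi / n : ℝ) : Circ)) ⁻¹' B) = ν.toMeasure B := by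
    have hm1 := (continuous_add_left ((2 * Real.pi / n : ℝ) : Circ)).measurable
    have h1 : ∀ B : Set Circ, MeasurableSet B →
        ν.toMeasure ((fun y => ((2 * Real.pi / n : ℝ) : Circ) + y) ⁻¹' B) = ν.toMeasure B := by
      intro B hB
      rw [← Measure.map_apply hm1 hB]
      exact congrArg (fun ρ : ProbabilityMeasure Circ => ρ.toMeasure B) hν
    intro B hB k
    induction k with
    | zero => simp
    | succ k ih =>
      rw [← ih, ← h1 _ (hm k hB)]
      congr 1
      ext y
      simp only [mem_preimage, succ_nsmul]
      rw [show y + (k • ((2 * Real.pi / n : ℝ) : Circ) + ((2 * Real.pi / n : ℝ) : Circ))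
        = ((2 * Real.pi / n : ℝ) : Circ) + y + k • ((2 * Real.pi / n : ℝ) : Circ) by abel]
  apply Subtype.ext
  apply Measure.ext
  intro B hB
  change gm n _ B = ν.toMeasure B
  rw [gm_apply n _ hB]
  have h1 : ∀ t : Fin n, (ν.map (f := fun y => n • y) (measurable_q n).aemeasurable).toMeasure
      (divMap n t ⁻¹' B)
      = ∫⁻ y, B.indicator (fun _ => (1 : ℝ≥0∞)) (divMap n t (n • y)) ∂ν.toMeasure := by
    intro t
    change (ν.toMeasure.map (fun y => n • y)) _ = _
    rw [Measure.map_apply (measurable_q n) (measurable_divMap n t hB),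
      ← lintegral_indicator_one (measurable_q n (measurable_divMap n t hB))]
    rfl
  simp only [h1]
  rw [← lintegral_finsetSum]
  swap
  · exact fun t _ =>
      (measurable_const.indicator hB).comp ((measurable_divMap n t).comp (measurable_q n))
  have h2 : ∀ y, ∑ t : Fin n, B.indicator (fun _ => (1 : ℝ≥0∞)) (divMap n t (n • y)) = _ :=
    fun y => sum_divMap hn (fun z => B.indicator (fun _ => (1 : ℝ≥0∞)) z) y
  simp only [h2]
  rw [lintegral_finsetSum]
  swap
  · exact fun k _ => (measurable_const.indicator hB).comp (hm k)
  have h3 : ∀ k : ℕ, ∫⁻ y, B.indicator (fun _ => (1 : ℝ≥0∞))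
      (y + k • ((2 * Real.pi / n : ℝ) : Circ)) ∂ν.toMeasure = ν.toMeasure B := by
    intro k
    rw [← hinv B hB k, ← lintegral_indicator_one (hm k hB)]
    rfl
  simp only [h3, Finset.sum_const, Finset.card_range, nsmul_eq_mul]
  rw [← mul_assoc, ENNReal.inv_mul_cancel (by exact_mod_cast h0) (by simp), one_mul]

lemma finSupp_map {n : ℕ} {ν : ProbabilityMeasure Circ} (h : FinSupp ν) :
    FinSupp (ν.map (f := fun y => n • y) (measurable_q n).aemeasurable) := by
  classical
  obtain ⟨S, hS⟩ := h
  refine ⟨S.image (fun y => n • y), ?_⟩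
  refine le_antisymm prob_le_one ?_
  change 1 ≤ (ν.toMeasure.map (fun y => n • y)) _
  rw [Measure.map_apply (measurable_q n) (Finset.measurableSet _), ← hS]
  refine measure_mono ?_
  intro y hy
  simp only [Finset.coe_image, mem_preimage]
  exact ⟨y, hy, rfl⟩

/-- For odd `n ≥ 1` and `0 < s ≤ π`, the map `g_n : VR^m(S¹; π−s) → VR^m(S¹; π−s/n)` is
continuous and injective, and its image is exactly the fixed-point set of the rotation
by `2π/n`. -/
theorem gmap_continuous_injective_image (n : ℕ) (hodd : Odd n) (hn : 1 ≤ n) (s : ℝ)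
    (hs0 : 0 < s) (hsπ : s ≤ Real.pi) :
    (∀ μ ∈ VRm Circ (Real.pi - s),
      gPM n (Nat.one_le_iff_ne_zero.mp hn) μ ∈ VRm Circ (Real.pi - s / n)) ∧
    Continuous (fun μ : ↥(VRm Circ (Real.pi - s)) =>
      gPM n (Nat.one_le_iff_ne_zero.mp hn) μ.1) ∧
    Set.InjOn (gPM n (Nat.one_le_iff_ne_zero.mp hn)) (VRm Circ (Real.pi - s)) ∧
    (gPM n (Nat.one_le_iff_ne_zero.mp hn)) '' (VRm Circ (Real.pi - s))
      = {μ : ProbabilityMeasure Circ | μ ∈ VRm Circ (Real.pi - s / n) ∧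
          rot ((2 * Real.pi / n : ℝ) : Circ) μ = μ} := by
  have h0 : n ≠ 0 := Nat.one_le_iff_ne_zero.mp hn
  have hn' : (1 : ℝ) ≤ n := by exact_mod_cast hn
  have hmem : ∀ μ ∈ VRm Circ (Real.pi - s), gPM n h0 μ ∈ VRm Circ (Real.pi - s / n) := by
    rintro μ ⟨hf, hd⟩
    refine ⟨finSupp_gPM hn h0 hf, ?_⟩
    have hs1 : s / n ≤ s := div_le_self hs0.le hn'
    refine Metric.diam_le_of_forall_dist_le (by linarith) fun y hy y' hy' => ?_
    rw [mem_mSupport_gPM hn h0] at hy hy'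
    refine dist_up hodd hn ((Metric.dist_le_diam_of_mem ?_ hy hy').trans hd)
    exact isCompact_univ.isBounded.subset (subset_univ _)
  refine ⟨hmem, (continuous_gPM hn h0).comp continuous_subtype_val,
    (gPM_injective hn h0).injOn, ?_⟩
  ext ν
  constructor
  · rintro ⟨μ, hμ, rfl⟩
    exact ⟨hmem μ hμ, rot_gPM hn h0 μ⟩
  · rintro ⟨⟨hf, hd⟩, hr⟩
    have hg := gPM_map hn h0 ν hr
    refine ⟨_, ⟨finSupp_map hf, ?_⟩, hg⟩
    refine Metric.diam_le_of_forall_dist_le (by linarith) fun x hx x' hx' => ?_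
    refine dist_down hodd hn fun y y' hy hy' => ?_
    subst hy hy'
    rw [← mem_mSupport_gPM hn h0, hg] at hx hx'
    refine (Metric.dist_le_diam_of_mem ?_ hx hx').trans hd
    exact isCompact_univ.isBounded.subset (subset_univ _)
end
end

section
/- For every integer k ≥ 1, the space P̄_{2k+1} is homeomorphic to D^{2k} × S^1, the product of a closed 2k-dimensional disk with a circle, and ∂P_{2k+1} is homeomorphic to S^{2k−1} × S^1. -/
open MeasureTheory Metric Set
open scoped NNReal ENNReal

noncomputable section

/-- The polygonal measure `Σ_j a_j δ_{θ + 2πj/n}` on the circle `ℝ/2πℤ`. -/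
def polyM (n : ℕ) (a : Fin n → ℝ≥0) (θ : ℝ) : Measure Circ :=
  ∑ j : Fin n, (a j : ℝ≥0∞) • Measure.dirac ((θ + 2 * Real.pi * j / n : ℝ) : Circ)

/-- `P̄_{2k+1}`: the space of probability measures of the form `Σ_j a_j δ_{θ+2πj/(2k+1)}`,
as a subspace of the probability measures on the circle with the topology of weak
convergence. -/
def Pbar (k : ℕ) : Set (ProbabilityMeasure Circ) :=
  {μ | ∃ (a : Fin (2 * k + 1) → ℝ≥0) (θ : ℝ),
    (∑ j, a j = 1) ∧ μ.toMeasure = polyM (2 * k + 1) a θ}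

/-- `∂P_{2k+1} ⊆ P̄_{2k+1}`: the measures for which some coefficient vanishes. -/
def PbarBdry (k : ℕ) : Set (ProbabilityMeasure Circ) :=
  {μ | ∃ (a : Fin (2 * k + 1) → ℝ≥0) (θ : ℝ),
    (∑ j, a j = 1) ∧ (∃ j, a j = 0) ∧ μ.toMeasure = polyM (2 * k + 1) a θ}


/-- General principle: two continuous maps from a compact space to Hausdorff spaces with the same
fibres have homeomorphic images (of closed sets). -/
lemma homeo_of_same_fibres {X Y Z : Type*} [TopologicalSpace X] [TopologicalSpace Y]
    [TopologicalSpace Z] [T2Space Y] [T2Space Z] (K : Set X) (hK : IsCompact K)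
    (f : X → Y) (g : X → Z) (hf : Continuous f) (hg : Continuous g)
    (h : ∀ x y, f x = f y ↔ g x = g y) : Nonempty (↥(f '' K) ≃ₜ ↥(g '' K)) := by
  have : CompactSpace K := isCompact_iff_compactSpace.1 hK
  let F : C(K, f '' K) := ⟨fun x => ⟨f x, x, x.2, rfl⟩, by fun_prop⟩
  let G : C(K, g '' K) := ⟨fun x => ⟨g x, x, x.2, rfl⟩, by fun_prop⟩
  have hF : Topology.IsQuotientMap F := .of_surjective_continuous (by
    rintro ⟨_, x, hx, rfl⟩; exact ⟨⟨x, hx⟩, rfl⟩) F.continuous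
  have hG : Topology.IsQuotientMap G := .of_surjective_continuous (by
    rintro ⟨_, x, hx, rfl⟩; exact ⟨⟨x, hx⟩, rfl⟩) G.continuous
  have hker : Setoid.ker F = Setoid.ker G := by
    ext x y
    rw [Setoid.ker_def, Setoid.ker_def]
    exact Subtype.ext_iff.trans ((h x y).trans (Subtype.ext_iff (a1 := G x) (a2 := G y)).symm)
  have e := hG.homeomorph
  rw [← hker] at e
  exact ⟨hF.homeomorph.symm.trans e⟩

/-- The generator of the group of `2k+1`-torsion points. -/
def tor (k : ℕ) : Circ := ((2 * Real.pi / (2 * k + 1 : ℕ) : ℝ) : Circ)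

/-- The vertices of the regular polygon. -/
def pt (k : ℕ) (j : Fin (2 * k + 1)) (θ : Circ) : Circ := θ + (j : ℕ) • tor k

lemma tor_nsmul (k m : ℕ) :
    m • tor k = ((2 * Real.pi * m / (2 * k + 1 : ℕ) : ℝ) : Circ) := by
  rw [tor, ← AddCircle.coe_nsmul]
  congr 1
  rw [nsmul_eq_mul]; ring

lemma tor_tors (k : ℕ) : (2 * k + 1) • tor k = 0 := by
  rw [tor_nsmul, mul_div_assoc, div_self (by positivity), mul_one]
  exact AddCircle.coe_period _

lemma pt_tors (k : ℕ) (j : Fin (2 * k + 1)) (θ : Circ) :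
    (2 * k + 1) • pt k j θ = (2 * k + 1) • θ := by
  rw [pt, nsmul_add, ← mul_nsmul', mul_nsmul, tor_tors, nsmul_zero, add_zero]

lemma pt_add (k : ℕ) (j l : Fin (2 * k + 1)) (θ : Circ) :
    pt k j (θ + (l : ℕ) • tor k) = pt k (j + l) θ := by
  have h : ((j + l : Fin (2 * k + 1)) : ℕ) • tor k = ((j : ℕ) + (l : ℕ)) • tor k := by
    rw [Fin.val_add]
    conv_rhs => rw [← Nat.mod_add_div ((j : ℕ) + l) (2 * k + 1)]
    rw [add_nsmul, mul_nsmul, tor_tors, nsmul_zero, add_zero]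
  rw [pt, pt, h, add_nsmul]; abel

lemma exists_shift_s14 (k : ℕ) (θ φ : Circ) (h : (2 * k + 1) • θ = (2 * k + 1) • φ) :
    ∃ l : Fin (2 * k + 1), φ = θ + (l : ℕ) • tor k := by
  have h0 : (2 * k + 1) • (φ - θ) = 0 := by rw [nsmul_sub, h, sub_self]
  obtain ⟨m, hm, hm'⟩ := (AddCircle.nsmul_eq_zero_iff (by positivity)).1 h0
  refine ⟨⟨m, hm⟩, ?_⟩
  rw [tor_nsmul, ← sub_eq_iff_eq_add', ← hm']
  congr 1; ring

lemma addOrderOf_tor (k : ℕ) : addOrderOf (tor k) = 2 * k + 1 :=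
  AddCircle.addOrderOf_period_div (p := 2 * Real.pi) (n := 2 * k + 1) (by positivity)

lemma pt_injective (k : ℕ) (θ : Circ) : Function.Injective (fun j => pt k j θ) := by
  intro i j h
  have h1 : (i : ℕ) • tor k = (j : ℕ) • tor k := by simpa [pt] using h
  have h2 := addOrderOf_tor k
  apply Fin.ext
  exact nsmul_injOn_Iio_addOrderOf (by rw [h2]; exact i.2) (by rw [h2]; exact j.2) h1

/-- The vertices as complex numbers. -/
def cpt (k : ℕ) (j : Fin (2 * k + 1)) (θ : Circ) : ℂ := (AddCircle.toCircle (pt k j θ) : ℂ)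

lemma toCircle_inj {x y : Circ} (h : (AddCircle.toCircle x : ℂ) = AddCircle.toCircle y) :
    x = y :=
  AddCircle.injective_toCircle (by positivity) (Circle.coe_injective h)

lemma cpt_injective (k : ℕ) (θ : Circ) : Function.Injective (fun j => cpt k j θ) :=
  fun _ _ h => pt_injective k θ (toCircle_inj h)

lemma cpt_pow (k : ℕ) (j : Fin (2 * k + 1)) (θ : Circ) :
    cpt k j θ ^ (2 * k + 1) = AddCircle.toCircle ((2 * k + 1) • θ) := by
  rw [← pt_tors k j, AddCircle.toCircle_nsmul, Circle.coe_pow, cpt]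

lemma continuous_cpt (k : ℕ) (j : Fin (2 * k + 1)) : Continuous (cpt k j) := by
  unfold cpt pt
  exact continuous_subtype_val.comp (AddCircle.continuous_toCircle.comp (by fun_prop))

/-- Fourier coefficients `1..k` together with the total mass. -/
def four (k : ℕ) (θ : Circ) : (Fin (2 * k + 1) → ℝ) →ₗ[ℝ] (Fin k → ℂ) × ℝ where
  toFun a := (fun m => ∑ j, (a j : ℂ) * cpt k j θ ^ ((m : ℕ) + 1), ∑ j, a j)
  map_add' a b := by
    ext <;> simp [add_mul, Finset.sum_add_distrib]
  map_smul' c a := by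
    ext <;> simp [Finset.mul_sum, mul_assoc]

lemma four_injective (k : ℕ) (θ : Circ) : Function.Injective (four k θ) := by
  rw [← LinearMap.ker_eq_bot, LinearMap.ker_eq_bot']
  intro a ha
  have h1 : ∀ m : Fin k, ∑ j, (a j : ℂ) * cpt k j θ ^ ((m : ℕ) + 1) = 0 := fun m =>
    congrFun (congrArg Prod.fst ha) m
  have h0 : ∑ j, a j = 0 := congrArg Prod.snd ha
  have key : ∀ i : Fin (2 * k + 1), ∑ j, (a j : ℂ) * cpt k j θ ^ (i : ℕ) = 0 := by
    intro i
    rcases Nat.eq_zero_or_pos (i : ℕ) with hi | hi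
    · rw [hi]; simp only [pow_zero, mul_one]; exact_mod_cast h0
    · by_cases hk : (i : ℕ) ≤ k
      · have := h1 ⟨(i : ℕ) - 1, by omega⟩
        simpa [Nat.sub_add_cancel hi] using this
      · have h2 := h1 ⟨2 * k - i, by omega⟩
        have h3 : ∀ j, cpt k j θ ^ (i : ℕ) = AddCircle.toCircle ((2 * k + 1) • θ) *
            (starRingEnd ℂ) (cpt k j θ ^ (2 * k - (i : ℕ) + 1)) := by
          intro j
          rw [← cpt_pow k j θ, map_pow]
          have hn : cpt k j θ * (starRingEnd ℂ) (cpt k j θ) = 1 := by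
            rw [Complex.mul_conj, cpt]; simp
          have : cpt k j θ ^ (2 * k + 1) =
              cpt k j θ ^ (i : ℕ) * cpt k j θ ^ (2 * k - (i : ℕ) + 1) := by
            rw [← pow_add]; congr 1; omega
          rw [this, mul_assoc, ← mul_pow, hn, one_pow, mul_one]
        have h4 := congrArg (starRingEnd ℂ) h2
        simp only [map_sum, map_mul, map_zero, Complex.conj_ofReal] at h4
        simp only [h3]
        calc _ = (AddCircle.toCircle ((2 * k + 1) • θ) : ℂ) * ∑ j, (a j : ℂ) *
            (starRingEnd ℂ) (cpt k j θ ^ (2 * k - (i : ℕ) + 1)) := by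
              rw [Finset.mul_sum]; exact Finset.sum_congr rfl fun j _ => by ring
          _ = 0 := by rw [h4, mul_zero]
  have := Matrix.eq_zero_of_forall_pow_sum_mul_pow_eq_zero (cpt_injective k θ) key
  funext j
  have hj : (a j : ℂ) = 0 := congrFun this j
  exact_mod_cast hj

lemma four_surjective (k : ℕ) (θ : Circ) : Function.Surjective (four k θ) := by
  refine (LinearMap.injective_iff_surjective_of_finrank_eq_finrank ?_).1 (four_injective k θ)
  simp [Module.finrank_prod, Module.finrank_pi_fintype, mul_comm]

/-- A linear identification of `ℂ^k` with the Euclidean space of dimension `2k`. -/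
def eqv (k : ℕ) : (Fin k → ℂ) ≃L[ℝ] EuclideanSpace ℝ (Fin (2 * k)) :=
  ContinuousLinearEquiv.ofFinrankEq (by simp [Module.finrank_pi_fintype, mul_comm])

/-- Fourier coefficients in Euclidean space. -/
def zz (k : ℕ) (θ : Circ) : (Fin (2 * k + 1) → ℝ) →ₗ[ℝ] EuclideanSpace ℝ (Fin (2 * k)) :=
  (eqv k).toLinearMap ∘ₗ LinearMap.fst ℝ _ _ ∘ₗ four k θ

lemma zz_apply (k : ℕ) (θ : Circ) (a : Fin (2 * k + 1) → ℝ) :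
    zz k θ a = eqv k (fun m => ∑ j, (a j : ℂ) * cpt k j θ ^ ((m : ℕ) + 1)) := rfl

lemma zz_inj (k : ℕ) (θ : Circ) (a b : Fin (2 * k + 1) → ℝ) (h : zz k θ a = zz k θ b)
    (hs : ∑ j, a j = ∑ j, b j) : a = b :=
  four_injective k θ (Prod.ext ((eqv k).injective h) hs)

lemma zz_surj (k : ℕ) (θ : Circ) (v : EuclideanSpace ℝ (Fin (2 * k))) :
    ∃ a, zz k θ a = v ∧ ∑ j, a j = 0 := by
  obtain ⟨a, ha⟩ := four_surjective k θ ((eqv k).symm v, 0)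
  refine ⟨a, ?_, congrArg Prod.snd ha⟩
  have : zz k θ a = eqv k (four k θ a).1 := rfl
  rw [this, ha]; simp

lemma sum_cpt_pow (k : ℕ) (θ : Circ) (m : ℕ) (hm : 0 < m) (hmk : m ≤ k) :
    ∑ j, cpt k j θ ^ m = 0 := by
  have hstep : ∀ j, cpt k (j + 1) θ = cpt k j θ * AddCircle.toCircle (tor k) := by
    intro j
    have h1 : ((1 : Fin (2 * k + 1)) : ℕ) = 1 := by
      rw [Fin.val_one']; exact Nat.mod_eq_of_lt (by omega)
    rw [cpt, ← pt_add, h1, one_nsmul, cpt, ← Circle.coe_mul, ← AddCircle.toCircle_add]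
    congr 2
    rw [pt, pt]; abel
  have hs : ∑ j, cpt k j θ ^ m = (∑ j, cpt k j θ ^ m) * (AddCircle.toCircle (tor k) : ℂ) ^ m := by
    rw [Finset.sum_mul]
    rw [← Equiv.sum_comp (Equiv.addRight (1 : Fin (2 * k + 1)))]
    refine Finset.sum_congr rfl fun j _ => ?_
    rw [Equiv.coe_addRight, hstep, mul_pow]
  by_contra hne
  have h1 : (AddCircle.toCircle (tor k) : ℂ) ^ m = 1 := by
    have : (∑ j, cpt k j θ ^ m) * (AddCircle.toCircle (tor k) : ℂ) ^ m
      = (∑ j, cpt k j θ ^ m) * 1 := by rw [← hs, mul_one]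
    exact mul_left_cancel₀ hne this
  have h2 : m • tor k = 0 := by
    apply toCircle_inj
    rw [AddCircle.toCircle_nsmul, AddCircle.toCircle_zero, Circle.coe_pow, h1, Circle.coe_one]
  have := addOrderOf_dvd_of_nsmul_eq_zero h2
  rw [addOrderOf_tor] at this
  have := Nat.le_of_dvd hm this
  omega

lemma zz_const (k : ℕ) (θ : Circ) (c : ℝ) : zz k θ (fun _ => c) = 0 := by
  rw [zz_apply]
  simp only [← Finset.mul_sum]
  rw [show (fun m : Fin k => (c : ℂ) * ∑ j, cpt k j θ ^ ((m : ℕ) + 1)) = 0 from ?_, map_zero]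
  funext m
  rw [sum_cpt_pow k θ _ (by omega) (by omega), mul_zero]; rfl

/-- The smallest weight. -/
def mn (k : ℕ) (a : Fin (2 * k + 1) → ℝ) : ℝ :=
  Finset.univ.inf' Finset.univ_nonempty a

lemma mn_le (k : ℕ) (a : Fin (2 * k + 1) → ℝ) (j : Fin (2 * k + 1)) : mn k a ≤ a j :=
  Finset.inf'_le _ (Finset.mem_univ j)

lemma exists_mn (k : ℕ) (a : Fin (2 * k + 1) → ℝ) : ∃ j, a j = mn k a := by
  obtain ⟨j, -, hj⟩ := Finset.exists_mem_eq_inf' (Finset.univ_nonempty) a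
  exact ⟨j, hj.symm⟩

lemma mn_eq (k : ℕ) (a : Fin (2 * k + 1) → ℝ) (c : ℝ) (h1 : ∀ j, c ≤ a j) (h2 : ∃ j, a j = c) :
    mn k a = c := by
  obtain ⟨j, hj⟩ := h2
  obtain ⟨i, hi⟩ := exists_mn k a
  exact le_antisymm (hj ▸ mn_le k a j) (hi ▸ h1 i)

lemma mn_affine (k : ℕ) (a : Fin (2 * k + 1) → ℝ) (s c : ℝ) (hs : 0 ≤ s) :
    mn k (fun j => s * a j + c) = s * mn k a + c := by
  apply mn_eq
  · intro j
    have := mul_le_mul_of_nonneg_left (mn_le k a j) hs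
    linarith
  · obtain ⟨j, hj⟩ := exists_mn k a
    exact ⟨j, by rw [hj]⟩

lemma mn_perm (k : ℕ) (a : Fin (2 * k + 1) → ℝ) (σ : Equiv.Perm (Fin (2 * k + 1))) :
    mn k (fun j => a (σ j)) = mn k a := by
  apply mn_eq
  · exact fun j => mn_le k a _
  · obtain ⟨j, hj⟩ := exists_mn k a
    exact ⟨σ.symm j, by simpa using hj⟩

lemma continuous_mn (k : ℕ) : Continuous (mn k) := by
  unfold mn
  exact Continuous.finset_inf'_apply _ fun i _ => continuous_apply i

/-- The gauge of the simplex with respect to its barycentre. -/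
def gg (k : ℕ) (a : Fin (2 * k + 1) → ℝ) : ℝ := 1 - (2 * k + 1) * mn k a

lemma sum_sub_mn (k : ℕ) (a : Fin (2 * k + 1) → ℝ) :
    ∑ j, (a j - mn k a) = ∑ j, a j - (2 * k + 1) * mn k a := by
  simp [Finset.sum_sub_distrib]

lemma gg_nonneg (k : ℕ) (a : Fin (2 * k + 1) → ℝ) (ha : ∑ j, a j = 1) : 0 ≤ gg k a := by
  have h := sum_sub_mn k a
  rw [ha] at h
  rw [gg, ← h]
  exact Finset.sum_nonneg fun j _ => sub_nonneg.2 (mn_le k a j)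

/-- The barycentre. -/
def bary (k : ℕ) : Fin (2 * k + 1) → ℝ := fun _ => 1 / (2 * k + 1)

lemma sum_bary (k : ℕ) : ∑ j, bary k j = 1 := by
  simp only [bary, Finset.sum_const, Finset.card_univ, Fintype.card_fin, nsmul_eq_mul]
  push_cast
  field_simp

lemma gg_bary (k : ℕ) : gg k (bary k) = 0 := by
  rw [gg, mn_eq k (bary k) (1 / (2 * k + 1)) (fun _ => le_rfl) ⟨0, rfl⟩]
  field_simp; ring

lemma eq_bary (k : ℕ) (a : Fin (2 * k + 1) → ℝ) (ha : ∑ j, a j = 1) (h : gg k a = 0) :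
    a = bary k := by
  have h1 : ∑ j, (a j - mn k a) = 0 := by rw [sum_sub_mn, ha]; exact h
  have h2 := (Finset.sum_eq_zero_iff_of_nonneg fun j _ => sub_nonneg.2 (mn_le k a j)).1 h1
  have h3 : (2 * k + 1) * mn k a = 1 := by rw [gg] at h; linarith
  funext j
  have := h2 j (Finset.mem_univ j)
  rw [bary, eq_div_iff (by positivity)]
  linear_combination (2 * k + 1) * this + h3

/-- The radially rescaled Fourier coefficients. -/
def hh (k : ℕ) (θ : Circ) (a : Fin (2 * k + 1) → ℝ) : EuclideanSpace ℝ (Fin (2 * k)) :=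
  (gg k a / ‖zz k θ a‖) • zz k θ a

lemma zz_bary (k : ℕ) (θ : Circ) : zz k θ (bary k) = 0 := zz_const k θ _

lemma zz_eq_zero (k : ℕ) (θ : Circ) (a : Fin (2 * k + 1) → ℝ) (ha : ∑ j, a j = 1)
    (h : zz k θ a = 0) : a = bary k :=
  zz_inj k θ a _ (by rw [h, zz_bary]) (by rw [ha, sum_bary])

lemma norm_hh (k : ℕ) (θ : Circ) (a : Fin (2 * k + 1) → ℝ) (ha : ∑ j, a j = 1) :
    ‖hh k θ a‖ = gg k a := by
  have h0 := gg_nonneg k a ha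
  by_cases h : zz k θ a = 0
  · rw [hh, h, smul_zero, norm_zero, zz_eq_zero k θ a ha h, gg_bary]
  · rw [hh, norm_smul, Real.norm_of_nonneg (by positivity),
      div_mul_cancel₀ _ (norm_ne_zero_iff.2 h)]

lemma zz_affine (k : ℕ) (θ : Circ) (a : Fin (2 * k + 1) → ℝ) (s c : ℝ) :
    zz k θ (fun j => s * a j + c) = s • zz k θ a := by
  have : (fun j => s * a j + c) = s • a + fun _ => c := rfl
  rw [this, map_add, map_smul, zz_const, add_zero]

lemma sum_affine (k : ℕ) (a : Fin (2 * k + 1) → ℝ) (s c : ℝ) :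
    ∑ j, (s * a j + c) = s * ∑ j, a j + (2 * k + 1) * c := by
  simp [Finset.sum_add_distrib, Finset.mul_sum]

lemma hh_inj (k : ℕ) (θ : Circ) (a b : Fin (2 * k + 1) → ℝ) (ha : ∑ j, a j = 1)
    (hb : ∑ j, b j = 1) (h : hh k θ a = hh k θ b) : a = b := by
  have hg : gg k a = gg k b := by rw [← norm_hh k θ a ha, ← norm_hh k θ b hb, h]
  by_cases h0 : gg k a = 0
  · rw [eq_bary k a ha h0, eq_bary k b hb (hg ▸ h0)]
  have ha0 : zz k θ a ≠ 0 := fun h' => h0 (by rw [zz_eq_zero k θ a ha h', gg_bary])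
  have hb0 : zz k θ b ≠ 0 := fun h' => h0 (by rw [hg, zz_eq_zero k θ b hb h', gg_bary])
  have hna := norm_pos_iff.2 ha0
  have hnb := norm_pos_iff.2 hb0
  set t : ℝ := ‖zz k θ a‖ / ‖zz k θ b‖ with ht
  have htpos : 0 < t := by positivity
  have hz : zz k θ a = t • zz k θ b := by
    rw [hh, hh, ← hg, div_eq_mul_inv, div_eq_mul_inv, mul_smul, mul_smul] at h
    have h' := smul_right_injective _ h0 h
    rw [ht, div_eq_mul_inv, mul_smul, ← h', smul_smul, mul_inv_cancel₀ hna.ne', one_smul]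
  have hab : a = fun j => t * b j + (1 - t) / (2 * k + 1) := by
    apply zz_inj k θ
    · rw [hz, zz_affine]
    · rw [sum_affine, ha, hb]; field_simp; ring
  have hm : gg k a = t * gg k b := by
    rw [hab, gg, mn_affine k b _ _ htpos.le, gg]; field_simp; ring
  have ht1 : t = 1 := by
    rw [← hg] at hm
    exact (mul_right_cancel₀ h0 (by rw [one_mul]; exact hm)).symm
  rw [hab, ht1]; funext j; simp

lemma hh_surj (k : ℕ) (θ : Circ) (v : EuclideanSpace ℝ (Fin (2 * k))) (hv : ‖v‖ ≤ 1) :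
    ∃ a ∈ stdSimplex ℝ (Fin (2 * k + 1)), hh k θ a = v := by
  by_cases h0 : v = 0
  · refine ⟨bary k, ⟨fun _ => by rw [bary]; positivity, sum_bary k⟩, ?_⟩
    rw [hh, zz_bary, smul_zero, h0]
  obtain ⟨x, hx, hs⟩ := zz_surj k θ v
  have hmn : mn k x < 0 := by
    by_contra! hcon
    have h1 := (Finset.sum_eq_zero_iff_of_nonneg
      fun j _ => hcon.trans (mn_le k x j)).1 hs
    have : x = fun _ => 0 := funext fun j => h1 j (Finset.mem_univ j)
    rw [this, zz_const] at hx
    exact h0 hx.symm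
  have hvp := norm_pos_iff.2 h0
  have hmp : 0 < -mn k x := by linarith
  set s : ℝ := ‖v‖ / ((2 * k + 1) * (-mn k x)) with hsdef
  have hspos : 0 < s := by positivity
  have hm : mn k (fun j => s * x j + 1 / (2 * k + 1)) = (1 - ‖v‖) / (2 * k + 1) := by
    rw [mn_affine k x _ _ hspos.le, hsdef]
    have : mn k x ≠ 0 := hmn.ne
    field_simp; ring
  refine ⟨fun j => s * x j + 1 / (2 * k + 1), ⟨fun j => ?_, ?_⟩, ?_⟩
  · refine le_trans ?_ (mn_le k (fun j => s * x j + 1 / (2 * k + 1)) j)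
    rw [hm]
    exact div_nonneg (by linarith) (by positivity)
  · rw [sum_affine, hs]; field_simp; ring
  · have hgg : gg k (fun j => s * x j + 1 / (2 * k + 1)) = ‖v‖ := by
      rw [gg, hm]; field_simp; ring
    rw [hh, hgg, zz_affine, hx, norm_smul, Real.norm_of_nonneg hspos.le, smul_smul]
    have : ‖v‖ / (s * ‖v‖) * s = 1 := by field_simp
    rw [this, one_smul]

lemma zz_shift (k : ℕ) (θ : Circ) (l : Fin (2 * k + 1)) (a : Fin (2 * k + 1) → ℝ) :
    zz k (θ + (l : ℕ) • tor k) a = zz k θ (fun j => a ((Equiv.subRight l) j)) := by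
  rw [zz_apply, zz_apply]
  congr 1
  funext m
  rw [← Equiv.sum_comp (Equiv.subRight l)]
  refine Finset.sum_congr rfl fun j _ => ?_
  rw [cpt, pt_add, Equiv.subRight_apply, sub_add_cancel, cpt]

lemma hh_shift (k : ℕ) (θ : Circ) (l : Fin (2 * k + 1)) (a : Fin (2 * k + 1) → ℝ) :
    hh k (θ + (l : ℕ) • tor k) a = hh k θ (fun j => a ((Equiv.subRight l) j)) := by
  rw [hh, hh, zz_shift, gg, gg, mn_perm]

/-- The polygonal measure, with real weights and the angle in the circle. -/
def QM (k : ℕ) (θ : Circ) (a : Fin (2 * k + 1) → ℝ) : Measure Circ :=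
  ∑ j, ENNReal.ofReal (a j) • Measure.dirac (pt k j θ)

lemma QM_shift (k : ℕ) (θ : Circ) (l : Fin (2 * k + 1)) (a : Fin (2 * k + 1) → ℝ) :
    QM k (θ + (l : ℕ) • tor k) a = QM k θ (fun j => a ((Equiv.subRight l) j)) := by
  rw [QM, QM, ← Equiv.sum_comp (Equiv.subRight l)]
  refine Finset.sum_congr rfl fun j _ => ?_
  rw [pt_add, Equiv.subRight_apply, sub_add_cancel]

lemma QM_prob (k : ℕ) (θ : Circ) (a : Fin (2 * k + 1) → ℝ)
    (ha : a ∈ stdSimplex ℝ (Fin (2 * k + 1))) : IsProbabilityMeasure (QM k θ a) := by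
  constructor
  simp only [QM, Measure.coe_finsetSum, Finset.sum_apply, Measure.smul_apply, measure_univ,
    smul_eq_mul, mul_one]
  rw [← ENNReal.ofReal_sum_of_nonneg (fun j _ => ha.1 j), ha.2, ENNReal.ofReal_one]

lemma QM_integral {E : Type*} [NormedAddCommGroup E] [NormedSpace ℝ E] [CompleteSpace E] (k : ℕ)
    (θ : Circ) (a : Fin (2 * k + 1) → ℝ) (ha : a ∈ stdSimplex ℝ (Fin (2 * k + 1))) (f : Circ → E)  :
    ∫ x, f x ∂(QM k θ a) = ∑ j, a j • f (pt k j θ) := by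
  rw [QM, integral_finsetSum_measure]
  · refine Finset.sum_congr rfl fun j _ => ?_
    rw [integral_smul_measure, integral_dirac, ENNReal.toReal_ofReal (ha.1 j)]
  · intro j _
    exact (integrable_dirac (by simp)).smul_measure (by simp)

/-- The parameter space. -/
abbrev PX (k : ℕ) : Type := stdSimplex ℝ (Fin (2 * k + 1)) × Circ

instance (k : ℕ) : CompactSpace (stdSimplex ℝ (Fin (2 * k + 1))) :=
  isCompact_iff_compactSpace.1 (isCompact_stdSimplex _ _)

/-- The parametrization of `P̄`. -/
def QQ (k : ℕ) (x : PX k) : ProbabilityMeasure Circ :=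
  ⟨QM k x.2 x.1.1, QM_prob k x.2 x.1.1 x.1.2⟩

/-- The parametrization of disk times circle. -/
def GG (k : ℕ) (x : PX k) : EuclideanSpace ℝ (Fin (2 * k)) × Circ :=
  (hh k x.2 x.1.1, (2 * k + 1) • x.2)

lemma continuous_QQ (k : ℕ) : Continuous (QQ k) := by
  rw [ProbabilityMeasure.continuous_iff_forall_continuous_integral]
  intro f
  have : ∀ x : PX k, ∫ ω, f ω ∂(QQ k x : Measure Circ) = ∑ j, x.1.1 j • f (pt k j x.2) :=
    fun x => QM_integral k x.2 x.1.1 x.1.2 f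
  simp only [this]
  unfold pt
  have hj : ∀ j : Fin (2 * k + 1), Continuous fun x : PX k => x.1.1 j := fun j =>
    (continuous_apply j).comp (continuous_subtype_val.comp continuous_fst)
  exact continuous_finsetSum _ fun j _ => (hj j).smul (f.continuous.comp (by fun_prop))

lemma continuous_zz (k : ℕ) : Continuous fun x : PX k => zz k x.2 x.1.1 := by
  simp only [zz_apply]
  have hj : ∀ j : Fin (2 * k + 1), Continuous fun x : PX k => x.1.1 j := fun j =>
    (continuous_apply j).comp (continuous_subtype_val.comp continuous_fst)
  refine (eqv k).continuous.comp (continuous_pi fun m => continuous_finsetSum _ fun j _ => ?_)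
  exact (Complex.continuous_ofReal.comp (hj j)).mul
    (((continuous_cpt k j).comp continuous_snd).pow _)

lemma continuous_GG (k : ℕ) : Continuous (GG k) := by
  have hg : Continuous fun x : PX k => gg k x.1.1 := by
    unfold gg
    exact continuous_const.sub (continuous_const.mul
      ((continuous_mn k).comp (continuous_subtype_val.comp continuous_fst)))
  have hz := continuous_zz k
  refine Continuous.prodMk ?_ (by fun_prop)
  rw [continuous_iff_continuousAt]
  intro x
  by_cases h : zz k x.2 x.1.1 = 0
  · have hx : x.1.1 = bary k := zz_eq_zero k _ _ x.1.2.2 h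
    have h0 : hh k x.2 x.1.1 = 0 := by rw [hh, h, smul_zero]
    rw [ContinuousAt, h0, tendsto_zero_iff_norm_tendsto_zero]
    have h1 : (fun y : PX k => ‖hh k y.2 y.1.1‖) = fun y => gg k y.1.1 :=
      funext fun y => norm_hh k _ _ y.1.2.2
    rw [h1]
    have := hg.tendsto x
    rwa [hx, gg_bary] at this
  · unfold hh
    exact (hg.continuousAt.div hz.norm.continuousAt (norm_ne_zero_iff.2 h)).smul hz.continuousAt

lemma reduce (k : ℕ) (x y : PX k) (h : (2 * k + 1) • x.2 = (2 * k + 1) • y.2) :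
    ∃ b : stdSimplex ℝ (Fin (2 * k + 1)), QQ k (b, x.2) = QQ k y ∧ GG k (b, x.2) = GG k y := by
  obtain ⟨l, hl⟩ := exists_shift_s14 k _ _ h
  refine ⟨⟨fun j => y.1.1 ((Equiv.subRight l) j), fun j => y.1.2.1 _, ?_⟩, ?_, ?_⟩
  · rw [Equiv.sum_comp (Equiv.subRight l) y.1.1]; exact y.1.2.2
  · apply Subtype.ext
    simp only [QQ]
    rw [hl, QM_shift]
  · simp only [GG]
    rw [h]
    congr 1
    rw [hl, hh_shift]

lemma same_fibres (k : ℕ) (x y : PX k) : QQ k x = QQ k y ↔ GG k x = GG k y := by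
  constructor
  · intro h
    have hI : ∀ f : Circ → ℂ,
        ∑ j, x.1.1 j • f (pt k j x.2) = ∑ j, y.1.1 j • f (pt k j y.2) := by
      intro f
      rw [← QM_integral k x.2 x.1.1 x.1.2 f, ← QM_integral k y.2 y.1.1 y.1.2 f]
      have : QM k x.2 x.1.1 = QM k y.2 y.1.1 := congrArg Subtype.val h
      rw [this]
    have hn : (2 * k + 1) • x.2 = (2 * k + 1) • y.2 := by
      apply toCircle_inj
      have := hI fun p => (AddCircle.toCircle ((2 * k + 1) • p) : ℂ)
      simp only [pt_tors] at this
      rw [← Finset.sum_smul, ← Finset.sum_smul, x.1.2.2, y.1.2.2, one_smul, one_smul] at this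
      exact this
    obtain ⟨b, hb, hb'⟩ := reduce k x y hn
    rw [← hb']
    have hzb : zz k x.2 x.1.1 = zz k x.2 b.1 := by
      have h' : QM k x.2 x.1.1 = QM k x.2 b.1 := congrArg Subtype.val (h.trans hb.symm)
      rw [zz_apply, zz_apply]
      congr 1
      funext m
      have h1 := QM_integral k x.2 x.1.1 x.1.2
        fun p => (AddCircle.toCircle p : ℂ) ^ ((m : ℕ) + 1)
      have h2 := QM_integral k x.2 b.1 b.2
        fun p => (AddCircle.toCircle p : ℂ) ^ ((m : ℕ) + 1)
      rw [h', h2] at h1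
      simpa [cpt] using h1.symm
    have hxb : x.1 = b := Subtype.ext (zz_inj k x.2 _ _ hzb (x.1.2.2.trans b.2.2.symm))
    rw [← hxb]
  · intro h
    have hn : (2 * k + 1) • x.2 = (2 * k + 1) • y.2 := congrArg Prod.snd h
    obtain ⟨b, hb, hb'⟩ := reduce k x y hn
    rw [← hb]
    have hxb : x.1 = b := Subtype.ext (hh_inj k x.2 _ _ x.1.2.2 b.2.2
      (congrArg Prod.fst (h.trans hb'.symm)))
    rw [← hxb]

/-- The boundary of the parameter space. -/
def BX (k : ℕ) : Set (PX k) := {x | ∃ j, x.1.1 j = 0}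

lemma gg_le_one (k : ℕ) (a : Fin (2 * k + 1) → ℝ) (ha : a ∈ stdSimplex ℝ (Fin (2 * k + 1))) :
    gg k a ≤ 1 := by
  obtain ⟨j, hj⟩ := exists_mn k a
  have h : 0 ≤ mn k a := hj ▸ ha.1 j
  have : 0 ≤ (2 * k + 1) * mn k a := by positivity
  rw [gg]; linarith

lemma gg_eq_one (k : ℕ) (a : Fin (2 * k + 1) → ℝ) (ha : a ∈ stdSimplex ℝ (Fin (2 * k + 1))) :
    gg k a = 1 ↔ ∃ j, a j = 0 := by
  have hN : (2 * k + 1 : ℝ) ≠ 0 := by positivity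
  constructor
  · intro h
    obtain ⟨j, hj⟩ := exists_mn k a
    refine ⟨j, ?_⟩
    rw [gg] at h
    have : (2 * k + 1) * mn k a = 0 := by linarith
    rw [hj]
    exact (mul_eq_zero.1 this).resolve_left hN
  · intro h
    rw [gg, mn_eq k a 0 ha.1 h]; simp

lemma isCompact_BX (k : ℕ) : IsCompact (BX k) := by
  have : BX k = ⋃ j, {x : PX k | x.1.1 j = 0} := by ext x; simp [BX]
  rw [this]
  refine (isClosed_iUnion_of_finite fun j => isClosed_eq ?_ continuous_const).isCompact
  exact (continuous_apply j).comp (continuous_subtype_val.comp continuous_fst)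

lemma nsmul_circ_surj (k : ℕ) (w : Circ) : ∃ θ : Circ, (2 * k + 1) • θ = w := by
  induction w using QuotientAddGroup.induction_on with
  | H t =>
    refine ⟨((t / (2 * k + 1 : ℕ) : ℝ) : Circ), ?_⟩
    rw [← AddCircle.coe_nsmul, nsmul_eq_mul, mul_div_cancel₀ _ (by positivity)]

lemma GG_image_univ (k : ℕ) :
    GG k '' univ = closedBall (0 : EuclideanSpace ℝ (Fin (2 * k))) 1 ×ˢ (univ : Set Circ) := by
  ext ⟨v, w⟩
  simp only [image_univ, mem_range, mem_prod, mem_closedBall_zero_iff, mem_univ, and_true]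
  constructor
  · rintro ⟨x, hx⟩
    rw [← show hh k x.2 x.1.1 = v from congrArg Prod.fst hx, norm_hh _ _ _ x.1.2.2]
    exact gg_le_one k _ x.1.2
  · intro hv
    obtain ⟨θ, rfl⟩ := nsmul_circ_surj k w
    obtain ⟨a, ha, rfl⟩ := hh_surj k θ v hv
    exact ⟨(⟨a, ha⟩, θ), rfl⟩

lemma GG_image_BX (k : ℕ) :
    GG k '' BX k = sphere (0 : EuclideanSpace ℝ (Fin (2 * k))) 1 ×ˢ (univ : Set Circ) := by
  ext ⟨v, w⟩
  simp only [mem_image, mem_prod, mem_sphere_zero_iff_norm, mem_univ, and_true]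
  constructor
  · rintro ⟨x, hxB, hx⟩
    rw [← show hh k x.2 x.1.1 = v from congrArg Prod.fst hx, norm_hh _ _ _ x.1.2.2]
    exact (gg_eq_one k _ x.1.2).2 hxB
  · intro hv
    obtain ⟨θ, rfl⟩ := nsmul_circ_surj k w
    obtain ⟨a, ha, rfl⟩ := hh_surj k θ v hv.le
    rw [norm_hh _ _ _ ha.2] at hv
    exact ⟨(⟨a, ha⟩, θ), (gg_eq_one k _ ha).1 hv, rfl⟩

lemma polyM_eq (k : ℕ) (a : Fin (2 * k + 1) → ℝ≥0) (θ : ℝ) :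
    polyM (2 * k + 1) a θ = QM k (θ : Circ) (fun j => (a j : ℝ)) := by
  rw [polyM, QM]
  refine Finset.sum_congr rfl fun j _ => ?_
  rw [ENNReal.ofReal_coe_nnreal, pt, tor_nsmul, ← AddCircle.coe_add]

lemma QQ_eq (k : ℕ) (x : PX k) : ∃ (a : Fin (2 * k + 1) → ℝ≥0) (θ : ℝ),
    (∀ j, (a j : ℝ) = x.1.1 j) ∧ ∑ j, a j = 1 ∧
      (QQ k x).toMeasure = polyM (2 * k + 1) a θ := by
  obtain ⟨⟨a, ha⟩, w⟩ := x
  obtain ⟨t, rfl⟩ := QuotientAddGroup.mk_surjective w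
  have h : ∀ j, ((a j).toNNReal : ℝ) = a j := fun j => Real.coe_toNNReal _ (ha.1 j)
  refine ⟨fun j => (a j).toNNReal, t, h, ?_, ?_⟩
  · apply NNReal.eq
    rw [NNReal.coe_sum]
    simp only [h]
    exact ha.2
  · rw [polyM_eq]
    simp only [h]
    rfl

lemma coe_mem_simplex (k : ℕ) (a : Fin (2 * k + 1) → ℝ≥0) (hs : ∑ j, a j = 1) :
    (fun j => (a j : ℝ)) ∈ stdSimplex ℝ (Fin (2 * k + 1)) := by
  refine ⟨fun j => (a j).2, ?_⟩
  rw [← NNReal.coe_sum, hs, NNReal.coe_one]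

lemma QQ_image_univ (k : ℕ) : QQ k '' univ = Pbar k := by
  ext μ
  simp only [image_univ, mem_range, Pbar, mem_ofPred_eq]
  constructor
  · rintro ⟨x, rfl⟩
    obtain ⟨a, θ, -, hs, hθ⟩ := QQ_eq k x
    exact ⟨a, θ, hs, hθ⟩
  · rintro ⟨a, θ, hs, hμ⟩
    refine ⟨(⟨fun j => (a j : ℝ), coe_mem_simplex k a hs⟩, (θ : Circ)), ?_⟩
    apply Subtype.ext
    rw [polyM_eq] at hμ
    exact hμ.symm

lemma QQ_image_BX (k : ℕ) : QQ k '' BX k = PbarBdry k := by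
  ext μ
  simp only [mem_image, PbarBdry, mem_ofPred_eq]
  constructor
  · rintro ⟨x, ⟨j, hj⟩, rfl⟩
    obtain ⟨a, θ, ha, hs, hθ⟩ := QQ_eq k x
    exact ⟨a, θ, hs, ⟨j, NNReal.eq ((ha j).trans hj)⟩, hθ⟩
  · rintro ⟨a, θ, hs, ⟨j, hj⟩, hμ⟩
    refine ⟨(⟨fun j => (a j : ℝ), coe_mem_simplex k a hs⟩, (θ : Circ)),
      ⟨j, by simp [hj]⟩, ?_⟩
    apply Subtype.ext
    rw [polyM_eq] at hμ
    exact hμ.symm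

/-- The circle as a unit sphere in the Euclidean plane. -/
def circSphere : Circ ≃ₜ sphere (0 : EuclideanSpace ℝ (Fin 2)) 1 :=
  AddCircle.homeomorphCircle'.trans
    (Homeomorph.subtype (p := fun z : ℂ => z ∈ Submonoid.unitSphere ℂ)
      (q := fun v => v ∈ sphere (0 : EuclideanSpace ℝ (Fin 2)) 1)
      Complex.orthonormalBasisOneI.repr.toHomeomorph (fun z => by
        rw [← SetLike.mem_coe, Submonoid.coe_unitSphere]; simp))

/-- Assembling the target. -/
def prodHomeo {V : Type*} [TopologicalSpace V] (S : Set V) :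
    ↥(S ×ˢ (univ : Set Circ)) ≃ₜ S × sphere (0 : EuclideanSpace ℝ (Fin 2)) 1 :=
  (Homeomorph.Set.prod S univ).trans
    ((Homeomorph.refl S).prodCongr ((Homeomorph.Set.univ Circ).trans circSphere))

/-- For `k ≥ 1`, the space `P̄_{2k+1}` is homeomorphic to `D^{2k} × S¹` and `∂P_{2k+1}` is
homeomorphic to `S^{2k−1} × S¹`. -/
theorem Pbar_homeomorph_disk_prod_circle (k : ℕ) (hk : 1 ≤ k) :
    Nonempty (↥(Pbar k) ≃ₜ
      (↥(Metric.closedBall (0 : EuclideanSpace ℝ (Fin (2 * k))) 1) ×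
        ↥(Metric.sphere (0 : EuclideanSpace ℝ (Fin 2)) 1))) ∧
    Nonempty (↥(PbarBdry k) ≃ₜ
      (↥(Metric.sphere (0 : EuclideanSpace ℝ (Fin (2 * k))) 1) ×
        ↥(Metric.sphere (0 : EuclideanSpace ℝ (Fin 2)) 1))) := by

  obtain ⟨e⟩ := homeo_of_same_fibres univ isCompact_univ (QQ k) (GG k) (continuous_QQ k)
    (continuous_GG k) (same_fibres k)
  obtain ⟨e'⟩ := homeo_of_same_fibres (BX k) (isCompact_BX k) (QQ k) (GG k) (continuous_QQ k)
    (continuous_GG k) (same_fibres k)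
  rw [QQ_image_univ, GG_image_univ] at e
  rw [QQ_image_BX, GG_image_BX] at e'
  exact ⟨⟨e.trans (prodHomeo _)⟩, ⟨e'.trans (prodHomeo _)⟩⟩
end
end
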